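/- Let P be a left cancellative monoid and let φ₁, φ₂ be characters. Suppose Z ∈ J(P) satisfies φ₁(Z) = 1 and φ₂(Z) = 0, and suppose X, Y ∈ J(P) satisfy X ∪ Y ∈ J(P) and φ₁(X ∪ Y) + φ₁(X ∩ Y) ≠ φ₁(X) + φ₁(Y). Set X' := Z ∩ X and Y' := Z ∩ Y. Then φ₁(X' ∪ Y') + φ₁(X' ∩ Y') − φ₁(X') − φ₁(Y') = 1 and φ₂(X' ∪ Y') + φ₂(X' ∩ Y') − φ₂(X') − φ₂(Y') = 0. -/

import Mathlib

open Set

/-- Image of `X` under left multiplication by `p`: `pX = {p*x : x ∈ X}`. -/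
def imgMul {P : Type*} [Monoid P] (p : P) (X : Set P) : Set P :=
  (fun x => p * x) '' X

/-- Preimage of `X` under left multiplication by `q`: `q⁻¹X = {r : q*r ∈ X}`. -/
def preMul {P : Type*} [Monoid P] (q : P) (X : Set P) : Set P :=
  (fun x => q * x) ⁻¹' X

/-- The constructible right ideals
`J(P) = {p₁⁻¹q₁⋯pₙ⁻¹qₙP : n ≥ 1, pᵢ,qᵢ ∈ P} ∪ {∅}`. -/
def JP (P : Type*) [Monoid P] : Set (Set P) :=
  {X | X = ∅ ∨ ∃ l : List (P × P), l ≠ [] ∧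
    X = l.foldr (fun pq Y => preMul pq.1 (imgMul pq.2 Y)) Set.univ}

/-- The chain map `g(X) = qₙ⁻¹(pₙ(⋯(q₁⁻¹(p₁X))⋯))` associated to the list
`[(p₁,q₁),…,(pₙ,qₙ)]`. -/
def chainMap {P : Type*} [Monoid P] (l : List (P × P)) (X : Set P) : Set P :=
  l.foldl (fun Y pq => preMul pq.2 (imgMul pq.1 Y)) X

/-- `φ : Set P → ℝ` satisfies the ∨-condition if for all `X, Y ∈ J(P)` with
`X ∪ Y ∈ J(P)` one has `φ(X ∪ Y) = φ(X) + φ(Y) − φ(X ∩ Y)`. -/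
def VeeCond {P : Type*} [Monoid P] (φ : Set P → ℝ) : Prop :=
  ∀ X ∈ JP P, ∀ Y ∈ JP P, X ∪ Y ∈ JP P → φ (X ∪ Y) = φ X + φ Y - φ (X ∩ Y)

/-- A character: `φ(X) ∈ {0,1}` for `X ∈ J(P)`, `φ(P) = 1`, `φ(∅) = 0`, and
`φ(X ∩ Y) = φ(X)·φ(Y)` for all `X, Y ∈ J(P)`. -/
def IsCharacter {P : Type*} [Monoid P] (φ : Set P → ℝ) : Prop :=
  (∀ X ∈ JP P, φ X = 0 ∨ φ X = 1) ∧ φ (Set.univ : Set P) = 1 ∧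
    φ (∅ : Set P) = 0 ∧ ∀ X ∈ JP P, ∀ Y ∈ JP P, φ (X ∩ Y) = φ X * φ Y

theorem preMul_imgMul_mem_JP {P : Type*} [Monoid P] (p q : P) {Y : Set P} (hY : Y ∈ JP P) :
    preMul p (imgMul q Y) ∈ JP P := by
  rcases hY with rfl | ⟨l, -, rfl⟩
  · exact Or.inl (by simp [preMul, imgMul])
  · exact Or.inr ⟨(p, q) :: l, by simp, rfl⟩

theorem preMul_imgMul_inter {P : Type*} [Monoid P]
    (hP : ∀ p x y : P, p * x = p * y → x = y) (p q : P) (W Y : Set P) :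
    preMul p (imgMul q W) ∩ Y =
      preMul p (imgMul q (W ∩ preMul q (imgMul p Y))) := by
  ext x
  constructor
  · rintro ⟨⟨w, hw, hwx⟩, hx⟩
    exact ⟨w, ⟨hw, x, hx, hwx.symm⟩, hwx⟩
  · rintro ⟨w, ⟨hw, y, hy, hyw⟩, hwx⟩
    obtain rfl := hP p y x (hyw.trans hwx)
    exact ⟨⟨w, hw, hwx⟩, hy⟩

theorem inter_mem_JP {P : Type*} [Monoid P]
    (hP : ∀ p x y : P, p * x = p * y → x = y) {X Y : Set P}
    (hX : X ∈ JP P) (hY : Y ∈ JP P) : X ∩ Y ∈ JP P := by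
  rcases hX with rfl | ⟨l, -, rfl⟩
  · exact Or.inl (Set.empty_inter Y)
  · induction l generalizing Y with
    | nil => simpa using hY
    | cons a l ih =>
      rw [List.foldr_cons, preMul_imgMul_inter hP]
      exact preMul_imgMul_mem_JP _ _ (ih (preMul_imgMul_mem_JP _ _ hY))

theorem stmt_10 {P : Type*} [Monoid P]
    (hP : ∀ p x y : P, p * x = p * y → x = y)
    (φ₁ φ₂ : Set P → ℝ) (hφ₁ : IsCharacter φ₁) (hφ₂ : IsCharacter φ₂)
    (Z : Set P) (hZ : Z ∈ JP P) (hZ₁ : φ₁ Z = 1) (hZ₂ : φ₂ Z = 0)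
    (X Y : Set P) (hX : X ∈ JP P) (hY : Y ∈ JP P) (hXY : X ∪ Y ∈ JP P)
    (h₁ : φ₁ (X ∪ Y) + φ₁ (X ∩ Y) ≠ φ₁ X + φ₁ Y) :
    φ₁ ((Z ∩ X) ∪ (Z ∩ Y)) + φ₁ ((Z ∩ X) ∩ (Z ∩ Y)) - φ₁ (Z ∩ X) - φ₁ (Z ∩ Y) = 1 ∧
      φ₂ ((Z ∩ X) ∪ (Z ∩ Y)) + φ₂ ((Z ∩ X) ∩ (Z ∩ Y)) - φ₂ (Z ∩ X) - φ₂ (Z ∩ Y) = 0 := by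
  have h_inter : (Z ∩ X) ∩ (Z ∩ Y) = Z ∩ (X ∩ Y) := (Set.inter_inter_distrib_left Z X Y).symm
  have hXY' := inter_mem_JP hP hX hY
  obtain ⟨h01, -, -, hmul⟩ := hφ₁
  obtain ⟨-, -, -, hmul₂⟩ := hφ₂
  rw [← Set.inter_union_distrib_left, h_inter, hmul Z hZ _ hXY, hmul Z hZ _ hXY',
    hmul Z hZ X hX, hmul Z hZ Y hY, hmul₂ Z hZ _ hXY, hmul₂ Z hZ _ hXY',
    hmul₂ Z hZ X hX, hmul₂ Z hZ Y hY, hZ₁, hZ₂]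
  refine ⟨?_, by ring⟩
  have hXU := hmul X hX _ hXY
  have hYU := hmul Y hY _ hXY
  rw [Set.inter_eq_left.mpr Set.subset_union_left] at hXU
  rw [Set.inter_eq_left.mpr Set.subset_union_right] at hYU
  rw [hmul X hX Y hY] at h₁ ⊢
  rcases h01 X hX with hx | hx <;> rcases h01 Y hY with hy | hy <;>
    rcases h01 _ hXY with hu | hu <;>
    rw [hx, hu] at hXU <;> rw [hy, hu] at hYU <;> rw [hx, hy, hu] at h₁ ⊢ <;> norm_num at *
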